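/- arXiv:2602.15175 — 4 statements merged into one kernel-verified Lean document; each statement's English description precedes it below -/
import Mathlib

section
/- Let a ≥ 1 and take b = 3, d = 3a. For every integer k ≥ 0, the ℂ-dimension of the degree-k homogeneous component of the ideal I_{a,3} ⊆ ℂ[u_0,u_1,u_2,u_3] equals (3a+1)·C(k−a+3, 3) − (3a+2)·C(k−a+2, 3) − (a(a+1)/2)·C(k−2a+3, 3) + (a²+a+2)·C(k−2a+2, 3) − (a(a+1)/2)·C(k−2a+1, 3), where for an integer n, C(n,3) denotes the binomial coefficient, equal to 0 when n < 3. (Numerical consequence of the minimal free resolution of I_{a,3} in Theorem 1.5.) -/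
open MvPolynomial

/-- The generic binary form `G = ∑_{i=0}^{b} u_i x^i y^{b-i}` of degree `b`,
viewed as a polynomial in two variables `x = X 0`, `y = X 1` with coefficients in
`R = MvPolynomial (Fin (b+1)) ℂ`. -/
noncomputable def genForm (b : ℕ) : MvPolynomial (Fin 2) (MvPolynomial (Fin (b + 1)) ℂ) :=
  ∑ i : Fin (b + 1),
    MvPolynomial.C (MvPolynomial.X i) *
      MvPolynomial.X (0 : Fin 2) ^ (i : ℕ) * MvPolynomial.X (1 : Fin 2) ^ (b - (i : ℕ))

/-- The coefficient `c_j ∈ R` of `x^j y^{ab-j}` in `G^a`. -/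
noncomputable def coeffC (a b j : ℕ) : MvPolynomial (Fin (b + 1)) ℂ :=
  MvPolynomial.coeff
    (Finsupp.single (0 : Fin 2) j + Finsupp.single (1 : Fin 2) (a * b - j))
    (genForm b ^ a)

/-- The ideal `I_{a,b} ⊆ R` generated by the coefficients `c_0, …, c_d` of `G^a`,
where `d = ab`. -/
noncomputable def Iab (a b : ℕ) : Ideal (MvPolynomial (Fin (b + 1)) ℂ) :=
  Ideal.span (Set.range fun j : Fin (a * b + 1) => coeffC a b (j : ℕ))

/-- `C3 n` is the binomial coefficient `C(n, 3)` for an integer argument `n`, equal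
to `0` when `n < 3`. -/
def C3 (n : ℤ) : ℤ := (n.toNat.choose 3 : ℤ)

theorem Finsupp.toLex_lt_toLex_fin_four {e f : Fin 4 →₀ ℕ} :
    toLex e < toLex f ↔ e 0 < f 0 ∨ e 0 = f 0 ∧ (e 1 < f 1 ∨ e 1 = f 1 ∧
      (e 2 < f 2 ∨ e 2 = f 2 ∧ e 3 < f 3)) := by
  rw [Finsupp.Lex.lt_iff]
  simp only [Fin.exists_fin_succ, Fin.forall_fin_succ, ofLex_toLex]
  simp [Fin.lt_def]
  tauto

theorem coeff_coeffC (a j : ℕ) (f : Fin 4 →₀ ℕ) :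
    coeff f (coeffC a 3 j) =
      if f 0 + f 1 + f 2 + f 3 = a ∧ f 1 + 2 * f 2 + 3 * f 3 = j then
        (Nat.multinomial Finset.univ f : ℂ) else 0 := by
  have hterm : ∀ κ : Fin 4 → ℕ,
      (Nat.multinomial Finset.univ κ : MvPolynomial (Fin 2) (MvPolynomial (Fin 4) ℂ)) *
      ∏ i : Fin 4, (C (X i) * X (0 : Fin 2) ^ (i : ℕ) * X (1 : Fin 2) ^ (3 - (i : ℕ))) ^ κ i =
      monomial (Finsupp.single 0 (κ 1 + 2 * κ 2 + 3 * κ 3) +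
        Finsupp.single 1 (3 * κ 0 + 2 * κ 1 + κ 2))
        (monomial (Finsupp.equivFunOnFinite.symm κ) (Nat.multinomial Finset.univ κ : ℂ)) := by
    intro κ
    have h1 : (monomial (Finsupp.equivFunOnFinite.symm κ) (Nat.multinomial Finset.univ κ : ℂ)) =
        (Nat.multinomial Finset.univ κ : MvPolynomial (Fin 4) ℂ) *
          (X 0 ^ κ 0 * X 1 ^ κ 1 * X 2 ^ κ 2 * X 3 ^ κ 3) := by
      rw [monomial_eq, Finsupp.prod_fintype _ _ (by simp)]
      simp [Fin.prod_univ_four]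
    rw [h1, monomial_eq, Finsupp.prod_fintype _ _ (by simp)]
    simp [Fin.prod_univ_four]
    ring
  rw [coeffC, genForm, Finset.sum_pow_eq_sum_piAntidiag]
  simp only [hterm, coeff_sum, coeff_monomial]
  have hcond : ∀ κ ∈ Finset.piAntidiag (Finset.univ : Finset (Fin 4)) a,
      coeff f (if (Finsupp.single (0 : Fin 2) (κ 1 + 2 * κ 2 + 3 * κ 3) +
        Finsupp.single 1 (3 * κ 0 + 2 * κ 1 + κ 2)) = Finsupp.single (0 : Fin 2) j +
          Finsupp.single (1 : Fin 2) (a * 3 - j) then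
        (monomial (Finsupp.equivFunOnFinite.symm κ) (Nat.multinomial Finset.univ κ : ℂ)) else 0) =
      if κ = f then (if f 0 + f 1 + f 2 + f 3 = a ∧ f 1 + 2 * f 2 + 3 * f 3 = j then
        (Nat.multinomial Finset.univ f : ℂ) else 0) else 0 := by
    intro κ hκ
    rw [Finset.mem_piAntidiag] at hκ
    have hs : κ 0 + κ 1 + κ 2 + κ 3 = a := by simpa [Fin.sum_univ_four] using hκ.1
    have hiff : (Finsupp.single (0 : Fin 2) (κ 1 + 2 * κ 2 + 3 * κ 3) +
        Finsupp.single 1 (3 * κ 0 + 2 * κ 1 + κ 2)) = Finsupp.single (0 : Fin 2) j +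
          Finsupp.single (1 : Fin 2) (a * 3 - j) ↔ κ 1 + 2 * κ 2 + 3 * κ 3 = j := by
      rw [Finsupp.ext_iff, Fin.forall_fin_two]
      simp
      omega
    have hf : Finsupp.equivFunOnFinite.symm κ = f ↔ κ = f := by
      rw [Equiv.symm_apply_eq]; rfl
    rw [apply_ite (coeff f)]
    simp only [hiff, coeff_monomial, hf, coeff_zero]
    by_cases h : κ = f
    · subst h; simp [hs]
    · simp [h]
  rw [Finset.sum_congr rfl hcond, Finset.sum_ite_eq']
  by_cases h : f 0 + f 1 + f 2 + f 3 = a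
  · rw [if_pos]
    simp [Finset.mem_piAntidiag, Fin.sum_univ_four, h]
  · simp [h]

/-- Every coefficient of a power `G^(a')` with `a ≤ a'` lies in the ideal of coefficients of `G^a`. -/
theorem coeffC_mem_Iab {a a' : ℕ} (h : a ≤ a') (b j : ℕ) : coeffC a' b j ∈ Iab a b := by
  have hG : (genForm b).IsHomogeneous b := by
    refine IsHomogeneous.sum _ _ _ fun i _ => ?_
    have := ((isHomogeneous_C (Fin 2) (X i : MvPolynomial (Fin (b + 1)) ℂ)).mul
      (isHomogeneous_X_pow (R := MvPolynomial (Fin (b + 1)) ℂ) (0 : Fin 2) (i : ℕ))).mul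
      (isHomogeneous_X_pow (R := MvPolynomial (Fin (b + 1)) ℂ) (1 : Fin 2) (b - (i : ℕ)))
    convert this using 1
    omega
  have hmem : genForm b ^ a ∈ (Iab a b).map (C : _ →+* MvPolynomial (Fin 2) _) := by
    rw [mem_map_C_iff]
    intro m
    by_cases hm : coeff m (genForm b ^ a) = 0
    · rw [hm]; exact zero_mem _
    have hd := (hG.pow a) hm
    have hd' : m 0 + m 1 = b * a := by
      simpa [Finsupp.weight_apply, Finsupp.sum_fintype, Fin.sum_univ_two] using hd
    have hlt : m 0 < a * b + 1 := by rw [mul_comm]; omega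
    have hm : m = Finsupp.single 0 (m 0) + Finsupp.single 1 (a * b - m 0) := by
      rw [Finsupp.ext_iff, Fin.forall_fin_two]
      simp
      rw [mul_comm]; omega
    rw [hm]
    exact Ideal.subset_span ⟨⟨m 0, hlt⟩, rfl⟩
  have : genForm b ^ a' ∈ (Iab a b).map (C : _ →+* MvPolynomial (Fin 2) _) := by
    rw [← Nat.sub_add_cancel h, pow_add]
    exact Ideal.mul_mem_left _ _ hmem
  exact mem_map_C_iff.1 this _

theorem MvPolynomial.coeff_prod_X_add_C_pow {σ A : Type*} [Fintype σ] [CommSemiring A]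
    (c : σ → A) (e γ : σ →₀ ℕ) :
    coeff γ (∏ i, (X i + C (c i)) ^ e i) = ∏ i, c i ^ (e i - γ i) * ((e i).choose (γ i) : A) := by
  classical
  have hterm : ∀ p : σ → ℕ, ∏ i, ((X i : MvPolynomial σ A) ^ p i * C (c i) ^ (e i - p i) *
      ((e i).choose (p i) : MvPolynomial σ A)) =
      monomial (Finsupp.equivFunOnFinite.symm p)
        (∏ i, c i ^ (e i - p i) * ((e i).choose (p i) : A)) := by
    intro p
    rw [monomial_eq, Finsupp.prod_fintype _ _ (by simp), map_prod, ← Finset.prod_mul_distrib]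
    refine Finset.prod_congr rfl fun i _ => ?_
    simp
    ring
  simp only [add_pow]
  rw [Finset.prod_univ_sum]
  simp only [hterm, coeff_sum, coeff_monomial]
  have hf : ∀ p : σ → ℕ, Finsupp.equivFunOnFinite.symm p = γ ↔ p = γ := by
    intro p
    rw [Equiv.symm_apply_eq]; rfl
  simp only [hf]
  rw [Finset.sum_ite_eq']
  split_ifs with h
  · rfl
  · simp only [Fintype.mem_piFinset, Finset.mem_range, not_forall] at h
    obtain ⟨i, hi⟩ := h
    rw [Finset.prod_eq_zero (Finset.mem_univ i)]
    simp [Nat.choose_eq_zero_of_lt (show e i < γ i by omega)]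

/-- The expansion `F ↦ F (p(t) + v)` around the twisted cubic `p(t) = (1, t, t², t³)`. -/
noncomputable def taylorTwistedCubic :
    MvPolynomial (Fin 4) ℂ →ₐ[ℂ] MvPolynomial (Fin 4) (Polynomial ℂ) :=
  aeval fun i => X i + C (Polynomial.X ^ (i : ℕ))

/-- The apolarity pairing `(F, r) ↦ ∑ f, f! F_f r_f`, as a linear form in `r`. -/
noncomputable def apolarPairing (F : MvPolynomial (Fin 4) ℂ) : MvPolynomial (Fin 4) ℂ →ₗ[ℂ] ℂ :=
  ∑ f ∈ F.support, (((∏ i, (f i).factorial : ℕ) : ℂ) * coeff f F) • lcoeff ℂ f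

theorem apolarPairing_apply (F r : MvPolynomial (Fin 4) ℂ) :
    apolarPairing F r =
      ∑ f ∈ F.support, ((∏ i, (f i).factorial : ℕ) : ℂ) * coeff f F * coeff f r := by
  simp [apolarPairing, LinearMap.sum_apply]

theorem coeff_taylorTwistedCubic (F : MvPolynomial (Fin 4) ℂ) (γ : Fin 4 →₀ ℕ) (j : ℕ) :
    (coeff γ (taylorTwistedCubic F)).coeff j = ∑ f ∈ F.support, coeff f F *
      ((∏ i, (f i).choose (γ i) : ℕ) : ℂ) *
        if (f 1 - γ 1) + 2 * (f 2 - γ 2) + 3 * (f 3 - γ 3) = j then 1 else 0 := by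
  conv_lhs => rw [F.as_sum]
  rw [map_sum, coeff_sum, Polynomial.finsetSum_coeff]
  refine Finset.sum_congr rfl fun f _ => ?_
  rw [taylorTwistedCubic, aeval_monomial, Finsupp.prod_fintype _ _ (by simp),
    IsScalarTower.algebraMap_apply ℂ (Polynomial ℂ), algebraMap_eq, coeff_C_mul,
    coeff_prod_X_add_C_pow, Polynomial.algebraMap_eq, Polynomial.coeff_C_mul, mul_assoc,
    Finset.prod_mul_distrib]
  have h1 : ∏ i : Fin 4, ((Polynomial.X : Polynomial ℂ) ^ (i : ℕ)) ^ (f i - γ i) =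
      Polynomial.X ^ ((f 1 - γ 1) + 2 * (f 2 - γ 2) + 3 * (f 3 - γ 3)) := by
    simp only [Fin.prod_univ_four, ← pow_mul, ← pow_add]
    congr 1
    simp
  have h2 : ∏ i : Fin 4, ((f i).choose (γ i) : Polynomial ℂ) =
      Polynomial.C ((∏ i, (f i).choose (γ i) : ℕ) : ℂ) := by simp
  rw [h1, h2, Polynomial.coeff_mul_C, Polynomial.coeff_X_pow]
  simp only [eq_comm (a := j), mul_comm]

theorem apolarPairing_monomial_mul_coeffC {a k : ℕ} {F : MvPolynomial (Fin 4) ℂ}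
    (hF : F.IsHomogeneous k)
    (hT : taylorTwistedCubic F ∈ idealOfVars (Fin 4) (Polynomial ℂ) ^ (k + 1 - a))
    (γ : Fin 4 →₀ ℕ) (j : ℕ) : apolarPairing F (monomial γ 1 * coeffC a 3 j) = 0 := by
  have hdeg : ∀ f ∈ F.support, f 0 + f 1 + f 2 + f 3 = k := by
    intro f hf
    have := hF (mem_support_iff.1 hf)
    simpa [Finsupp.weight_apply, Finsupp.sum_fintype, Fin.sum_univ_four] using this
  rw [apolarPairing_apply]
  by_cases hγ : γ 0 + γ 1 + γ 2 + γ 3 + a = k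
  · have hz : coeff γ (taylorTwistedCubic F) = 0 := by
      refine (mem_pow_idealOfVars_iff' _ _).1 hT γ ?_
      rw [Finsupp.degree_eq_sum, Fin.sum_univ_four]
      omega
    have hsum := coeff_taylorTwistedCubic F γ j
    rw [hz, Polynomial.coeff_zero] at hsum
    rw [← mul_zero ((a.factorial * ∏ i, (γ i).factorial : ℕ) : ℂ), hsum, Finset.mul_sum]
    refine Finset.sum_congr rfl fun f hf => ?_
    have hk := hdeg f hf
    rw [coeff_monomial_mul', coeff_coeffC]
    by_cases hle : γ ≤ f
    · have hle' : ∀ i, γ i ≤ f i := hle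
      have h0 := hle' 0
      have h1 := hle' 1
      have h2 := hle' 2
      have h3 := hle' 3
      have ha : (f - γ) 0 + (f - γ) 1 + (f - γ) 2 + (f - γ) 3 = a := by
        simp only [Finsupp.tsub_apply]; omega
      have hm := Nat.multinomial_spec Finset.univ (f - γ)
      rw [Fin.sum_univ_four, ha] at hm
      have hc : ∏ i, (f i).factorial = (∏ i, (f i).choose (γ i)) * (∏ i, (γ i).factorial) *
          ∏ i, ((f - γ) i).factorial := by
        rw [← Finset.prod_mul_distrib, ← Finset.prod_mul_distrib]
        exact Finset.prod_congr rfl fun i _ => (Nat.choose_mul_factorial_mul_factorial (hle' i)).symm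
      rw [if_pos hle, hc, ← hm]
      simp only [ha, true_and]
      by_cases hj : (f - γ) 1 + 2 * (f - γ) 2 + 3 * (f - γ) 3 = j
      · rw [if_pos hj, if_pos (by simpa only [Finsupp.tsub_apply] using hj)]
        push_cast
        ring
      · rw [if_neg hj, if_neg (by simpa only [Finsupp.tsub_apply] using hj)]
        simp
    · rw [if_neg hle]
      obtain ⟨i, hi⟩ : ∃ i, f i < γ i := by
        by_contra! h
        exact hle h
      have hz' : ∏ i, (f i).choose (γ i) = 0 :=
        Finset.prod_eq_zero (Finset.mem_univ i) (Nat.choose_eq_zero_of_lt hi)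
      simp [hz']
  · refine Finset.sum_eq_zero fun f hf => ?_
    have hk := hdeg f hf
    rw [coeff_monomial_mul', coeff_coeffC]
    split_ifs with hle h
    · have hle' : ∀ i, γ i ≤ f i := hle
      have h0 := hle' 0
      have h1 := hle' 1
      have h2 := hle' 2
      have h3 := hle' 3
      simp only [Finsupp.tsub_apply] at h
      omega
    · simp
    · simp

theorem apolarPairing_eq_zero_of_mem_Iab {a k : ℕ} {F r : MvPolynomial (Fin 4) ℂ}
    (hF : F.IsHomogeneous k)
    (hT : taylorTwistedCubic F ∈ idealOfVars (Fin 4) (Polynomial ℂ) ^ (k + 1 - a))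
    (hr : r ∈ Iab a 3) : apolarPairing F r = 0 := by
  suffices h : ∀ s, apolarPairing F (s * r) = 0 by simpa using h 1
  induction hr using Submodule.span_induction with
  | mem x hx =>
    obtain ⟨j, rfl⟩ := hx
    intro s
    induction s using MvPolynomial.induction_on' with
    | monomial γ c =>
      have : monomial γ c = c • monomial γ (1 : ℂ) := by simp [smul_monomial]
      rw [this, smul_mul_assoc, map_smul, apolarPairing_monomial_mul_coeffC hF hT, smul_zero]
    | add p q hp hq => rw [add_mul, map_add, hp, hq, add_zero]
  | zero => simp
  | add x y _ _ hx hy => intro s; rw [mul_add, map_add, hx, hy, add_zero]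
  | smul t x _ hx => intro s; rw [smul_eq_mul, ← mul_assoc]; exact hx _

/-- A subspace `M` has dimension `#B` when `B` is the set of trailing positions, with respect to
the coordinates `c`, of the nonzero elements of `M`. -/
theorem finrank_eq_card_of_trailing {K V ι : Type*} [Field K] [AddCommGroup V] [Module K V]
    [LinearOrder ι] (c : ι → V →ₗ[K] K) (M : Submodule K V) (B : Finset ι)
    (hB : ∀ e ∈ B, ∃ r ∈ M, c e r ≠ 0 ∧ ∀ f < e, c f r = 0)
    (hM : ∀ r ∈ M, r ≠ 0 → ∃ e ∈ B, c e r ≠ 0) : Module.finrank K M = B.card := by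
  classical
  let φ : M →ₗ[K] (B → K) := LinearMap.pi fun e => (c e).comp M.subtype
  have hφ : Function.Injective φ := by
    rw [← LinearMap.ker_eq_bot, LinearMap.ker_eq_bot']
    intro r hr
    by_contra h
    obtain ⟨e, he, hne⟩ := hM r r.2 (by simpa using h)
    exact hne (congrFun hr ⟨e, he⟩)
  have : FiniteDimensional K M := FiniteDimensional.of_injective φ hφ
  choose! r hrM hre hrf using hB
  have hli : LinearIndependent K fun e : B => (⟨r e, hrM e e.2⟩ : M) := by
    rw [Fintype.linearIndependent_iff]
    intro g hg
    by_contra! hne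
    obtain ⟨i, hi⟩ := hne
    let S := Finset.univ.filter fun e : B => g e ≠ 0
    have hS : S.Nonempty := ⟨i, by simpa [S] using hi⟩
    have hmin := S.min'_mem hS
    set e := S.min' hS
    have h := congrArg (fun x : M => c e x) hg
    simp only [AddSubmonoidClass.coe_finsetSum, Submodule.coe_smul, map_sum, map_smul,
      ZeroMemClass.coe_zero, map_zero] at h
    rw [Finset.sum_eq_single e] at h
    · have hge : g e ≠ 0 := by simpa [S] using hmin
      exact (mul_ne_zero hge (hre e e.2)) h
    · intro f _ hf
      by_cases hgf : g f = 0
      · simp [hgf]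
      · have : e ≤ f := S.min'_le f (by simpa [S] using hgf)
        have hlt : (e : ι) < f := lt_of_le_of_ne this fun h => hf (Subtype.ext h.symm)
        rw [hrf f f.2 e hlt, smul_zero]
    · simp
  apply le_antisymm
  · simpa using LinearMap.finrank_le_finrank_of_injective hφ
  · simpa using hli.fintype_card_le_finrank

/-- The exponents of the monomials outside the `n`-th power of `(u₀u₂, u₀u₃, u₁u₃)`, that is,
outside `(u₀, u₁)ⁿ ∩ (u₀, u₃)ⁿ ∩ (u₂, u₃)ⁿ`. -/
def IsStandardExponent (n : ℕ) (e : Fin 4 →₀ ℕ) : Prop :=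
  e 0 + e 1 < n ∨ e 0 + e 3 < n ∨ e 2 + e 3 < n

theorem exists_mem_Iab_trailing_of_le {a k : ℕ} {e γ : Fin 4 →₀ ℕ}
    (hk : e 0 + e 1 + e 2 + e 3 = k) (hγ : γ ≤ e) (ha : γ 0 + γ 1 + γ 2 + γ 3 + a ≤ k)
    (hmin : ∀ f : Fin 4 →₀ ℕ, γ ≤ f → f 0 + f 1 + f 2 + f 3 = k →
      f 1 + 2 * f 2 + 3 * f 3 = e 1 + 2 * e 2 + 3 * e 3 → ¬ toLex f < toLex e) :
    ∃ r ∈ homogeneousSubmodule (Fin 4) ℂ k ⊓ Submodule.restrictScalars ℂ (Iab a 3),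
      coeff e r ≠ 0 ∧ ∀ f : Fin 4 →₀ ℕ, toLex f < toLex e → coeff f r = 0 := by
  have hcoord : ∀ f : Fin 4 →₀ ℕ, γ ≤ f → γ 0 ≤ f 0 ∧ γ 1 ≤ f 1 ∧ γ 2 ≤ f 2 ∧ γ 3 ≤ f 3 :=
    fun f hf => ⟨hf 0, hf 1, hf 2, hf 3⟩
  have heγ := hcoord e hγ
  set m := k - (γ 0 + γ 1 + γ 2 + γ 3) with hm
  set j := e 1 + 2 * e 2 + 3 * e 3 - (γ 1 + 2 * γ 2 + 3 * γ 3) with hj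
  have key : ∀ f, coeff f (monomial γ 1 * coeffC m 3 j) ≠ 0 →
      γ ≤ f ∧ f 0 + f 1 + f 2 + f 3 = k ∧
        f 1 + 2 * f 2 + 3 * f 3 = e 1 + 2 * e 2 + 3 * e 3 := by
    intro f hf
    rw [coeff_monomial_mul', coeff_coeffC] at hf
    split_ifs at hf with hle h
    · have := hcoord f hle
      simp only [Finsupp.tsub_apply] at h
      refine ⟨hle, ?_, ?_⟩ <;> omega
    · simp at hf
    · simp at hf
  refine ⟨monomial γ 1 * coeffC m 3 j, ⟨?_, ?_⟩, ?_, ?_⟩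
  · rw [SetLike.mem_coe, mem_homogeneousSubmodule]
    intro f hf
    simpa [Finsupp.weight_apply, Finsupp.sum_fintype, Fin.sum_univ_four] using (key f hf).2.1
  · exact Ideal.mul_mem_left _ _ (coeffC_mem_Iab (by omega) 3 j)
  · rw [coeff_monomial_mul', if_pos hγ, coeff_coeffC, if_pos]
    · simpa using (Nat.multinomial_pos _ _).ne'
    · simp only [Finsupp.tsub_apply]
      omega
  · intro f hf
    by_contra h
    obtain ⟨h1, h2, h3⟩ := key f h
    exact hmin f h1 h2 h3 hf

theorem exists_mem_Iab_trailing {a k : ℕ} {e : Fin 4 →₀ ℕ} (hk : e 0 + e 1 + e 2 + e 3 = k)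
    (he : IsStandardExponent (k + 1 - a) e) :
    ∃ r ∈ homogeneousSubmodule (Fin 4) ℂ k ⊓ Submodule.restrictScalars ℂ (Iab a 3),
      coeff e r ≠ 0 ∧ ∀ f : Fin 4 →₀ ℕ, toLex f < toLex e → coeff f r = 0 := by
  have hle : ∀ p q : Fin 4, p ≠ q → ∀ f : Fin 4 →₀ ℕ,
      Finsupp.single p (e p) + Finsupp.single q (e q) ≤ f ↔ e p ≤ f p ∧ e q ≤ f q := by
    intro p q hpq f
    constructor
    · intro h
      have hp := h p
      have hq := h q
      simpa [hpq, hpq.symm] using And.intro hp hq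
    · rintro ⟨hp, hq⟩ i
      by_cases h1 : i = p
      · subst h1; simpa [hpq] using hp
      · by_cases h2 : i = q
        · subst h2; simpa [hpq] using hq
        · simp [h1, h2]
  obtain ⟨p, q, hpq, hlt, hmin⟩ : ∃ p q : Fin 4, p ≠ q ∧ e p + e q < k + 1 - a ∧
      ∀ f : Fin 4 →₀ ℕ, e p ≤ f p → e q ≤ f q → f 0 + f 1 + f 2 + f 3 = k →
        f 1 + 2 * f 2 + 3 * f 3 = e 1 + 2 * e 2 + 3 * e 3 → ¬ toLex f < toLex e := by
    simp only [Finsupp.toLex_lt_toLex_fin_four]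
    rcases he with h | h | h
    · exact ⟨0, 1, by decide, h, fun f _ _ _ _ => by omega⟩
    · exact ⟨0, 3, by decide, h, fun f _ _ _ _ => by omega⟩
    · exact ⟨2, 3, by decide, h, fun f _ _ _ _ => by omega⟩
  refine exists_mem_Iab_trailing_of_le hk ((hle p q hpq e).2 ⟨le_rfl, le_rfl⟩) ?_
    fun f hf => hmin f ((hle p q hpq f).1 hf).1 ((hle p q hpq f).1 hf).2
  have hsum : ∑ i, (Finsupp.single p (e p) + Finsupp.single q (e q)) i = e p + e q := by
    simp [Finset.sum_add_distrib, Finsupp.single_apply]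
  rw [Fin.sum_univ_four] at hsum
  omega

theorem degree_lex_quadric {i l p q : Fin 4}
    (h : toLex (Finsupp.single p 1 + Finsupp.single q 1 : Fin 4 →₀ ℕ) <
      toLex (Finsupp.single i 1 + Finsupp.single l 1)) :
    MonomialOrder.lex.degree (X i * X l - X p * X q : MvPolynomial (Fin 4) ℂ) =
      Finsupp.single i 1 + Finsupp.single l 1 := by
  have hX : ∀ s t : Fin 4, MonomialOrder.lex.degree (X s * X t : MvPolynomial (Fin 4) ℂ) =
      Finsupp.single s 1 + Finsupp.single t 1 := by
    intro s t
    rw [MonomialOrder.degree_mul (X_ne_zero s) (X_ne_zero t), MonomialOrder.degree_X,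
      MonomialOrder.degree_X]
  rw [MonomialOrder.degree_sub_of_lt, hX]
  rw [hX, hX]
  exact MonomialOrder.lex_lt_iff.2 h

theorem taylorTwistedCubic_quadric_mem {i l p q : Fin 4} (h : (i + l : ℕ) = p + q) :
    taylorTwistedCubic (X i * X l - X p * X q) ∈ idealOfVars (Fin 4) (Polynomial ℂ) := by
  have hX : ∀ s, (X s : MvPolynomial (Fin 4) (Polynomial ℂ)) ∈ idealOfVars (Fin 4) (Polynomial ℂ) :=
    fun s => Ideal.subset_span ⟨s, rfl⟩
  have hC : (C (Polynomial.X ^ (i : ℕ)) * C (Polynomial.X ^ (l : ℕ)) :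
      MvPolynomial (Fin 4) (Polynomial ℂ)) =
      C (Polynomial.X ^ (p : ℕ)) * C (Polynomial.X ^ (q : ℕ)) := by
    rw [← C_mul, ← C_mul, ← pow_add, ← pow_add, h]
  have : taylorTwistedCubic (X i * X l - X p * X q) =
      ((X l + C (Polynomial.X ^ (l : ℕ))) * X i + C (Polynomial.X ^ (i : ℕ)) * X l) -
      ((X q + C (Polynomial.X ^ (q : ℕ))) * X p + C (Polynomial.X ^ (p : ℕ)) * X q) := by
    simp only [taylorTwistedCubic, map_sub, map_mul, aeval_X]
    linear_combination hC
  rw [this]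
  exact sub_mem (add_mem (Ideal.mul_mem_left _ _ (hX _)) (Ideal.mul_mem_left _ _ (hX _)))
    (add_mem (Ideal.mul_mem_left _ _ (hX _)) (Ideal.mul_mem_left _ _ (hX _)))

theorem exists_leading_taylorTwistedCubic_mem {n k : ℕ} {e : Fin 4 →₀ ℕ}
    (hk : e 0 + e 1 + e 2 + e 3 = k) (he : ¬ IsStandardExponent n e) :
    ∃ F : MvPolynomial (Fin 4) ℂ, F.IsHomogeneous k ∧
      taylorTwistedCubic F ∈ idealOfVars (Fin 4) (Polynomial ℂ) ^ n ∧
      coeff e F ≠ 0 ∧ ∀ f : Fin 4 →₀ ℕ, toLex e < toLex f → coeff f F = 0 := by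
  simp only [IsStandardExponent, not_or, not_lt] at he
  obtain ⟨h01, h03, h23⟩ := he
  obtain ⟨α, β, γ, hn, h0, h1, h2, h3⟩ : ∃ α β γ : ℕ, α + β + γ = n ∧ α + β ≤ e 0 ∧ γ ≤ e 1 ∧
      α ≤ e 2 ∧ β + γ ≤ e 3 :=
    ⟨n - e 3, n - (n - e 3) - (n - e 0), n - e 0, by omega, by omega, by omega, by omega, by omega⟩
  let ρ : Fin 4 →₀ ℕ := Finsupp.equivFunOnFinite.symm
    ![e 0 - (α + β), e 1 - γ, e 2 - α, e 3 - (β + γ)]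
  let P : MvPolynomial (Fin 4) ℂ := X 0 * X 2 - X 1 * X 1
  let Q : MvPolynomial (Fin 4) ℂ := X 0 * X 3 - X 1 * X 2
  let S : MvPolynomial (Fin 4) ℂ := X 1 * X 3 - X 2 * X 2
  have hP : MonomialOrder.lex.degree P = Finsupp.single 0 1 + Finsupp.single 2 1 :=
    degree_lex_quadric (by rw [Finsupp.toLex_lt_toLex_fin_four]; simp)
  have hQ : MonomialOrder.lex.degree Q = Finsupp.single 0 1 + Finsupp.single 3 1 :=
    degree_lex_quadric (by rw [Finsupp.toLex_lt_toLex_fin_four]; simp)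
  have hS : MonomialOrder.lex.degree S = Finsupp.single 1 1 + Finsupp.single 3 1 :=
    degree_lex_quadric (by rw [Finsupp.toLex_lt_toLex_fin_four]; simp)
  have hP0 : P ≠ 0 := MonomialOrder.lex.ne_zero_of_degree_ne_zero (by
    rw [hP]; exact fun h => by simpa using DFunLike.congr_fun h 0)
  have hQ0 : Q ≠ 0 := MonomialOrder.lex.ne_zero_of_degree_ne_zero (by
    rw [hQ]; exact fun h => by simpa using DFunLike.congr_fun h 0)
  have hS0 : S ≠ 0 := MonomialOrder.lex.ne_zero_of_degree_ne_zero (by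
    rw [hS]; exact fun h => by simpa using DFunLike.congr_fun h 1)
  have hρ0 : (monomial ρ 1 : MvPolynomial (Fin 4) ℂ) ≠ 0 := by simp
  have hF0 : P ^ α * Q ^ β * S ^ γ * monomial ρ 1 ≠ 0 := by
    simp [hP0, hQ0, hS0]
  have hdeg : MonomialOrder.lex.degree (P ^ α * Q ^ β * S ^ γ * monomial ρ 1) = e := by
    rw [MonomialOrder.degree_mul (by simp [hP0, hQ0, hS0]) hρ0,
      MonomialOrder.degree_mul (by simp [hP0, hQ0]) (by simp [hS0]),
      MonomialOrder.degree_mul (by simp [hP0]) (by simp [hQ0]),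
      MonomialOrder.degree_pow, MonomialOrder.degree_pow, MonomialOrder.degree_pow, hP, hQ, hS,
      MonomialOrder.degree_monomial, if_neg one_ne_zero, Finsupp.ext_iff]
    simp [Fin.forall_fin_succ, ρ]
    omega
  have hquad : ∀ i l p q : Fin 4, (X i * X l - X p * X q : MvPolynomial (Fin 4) ℂ).IsHomogeneous 2 :=
    fun i l p q => ((isHomogeneous_X ℂ i).mul (isHomogeneous_X ℂ l)).sub
      ((isHomogeneous_X ℂ p).mul (isHomogeneous_X ℂ q))
  refine ⟨P ^ α * Q ^ β * S ^ γ * monomial ρ 1, ?_, ?_, ?_, ?_⟩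
  · have hρ : (monomial ρ 1 : MvPolynomial (Fin 4) ℂ).IsHomogeneous (k - 2 * n) := by
      apply isHomogeneous_monomial
      rw [Finsupp.degree_eq_sum, Fin.sum_univ_four]
      simp [ρ]
      omega
    have := ((((hquad 0 2 1 1).pow α).mul ((hquad 0 3 1 2).pow β)).mul
      ((hquad 1 3 2 2).pow γ)).mul hρ
    convert this using 1
    omega
  · rw [map_mul, map_mul, map_mul, map_pow, map_pow, map_pow, ← hn, pow_add, pow_add]
    exact Ideal.mul_mem_right _ _ (Ideal.mul_mem_mul (Ideal.mul_mem_mul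
      (Ideal.pow_mem_pow (taylorTwistedCubic_quadric_mem (by simp)) α)
      (Ideal.pow_mem_pow (taylorTwistedCubic_quadric_mem (by simp)) β))
      (Ideal.pow_mem_pow (taylorTwistedCubic_quadric_mem (by simp)) γ))
  · conv_lhs => rw [← hdeg]
    exact MonomialOrder.lex.coeff_degree_ne_zero_iff.2 hF0
  · intro f hf
    apply MonomialOrder.lex.coeff_eq_zero_of_lt
    rw [hdeg]
    exact MonomialOrder.lex_lt_iff.2 hf

theorem isStandardExponent_of_mem_Iab {a k : ℕ} {e : Fin 4 →₀ ℕ} {r : MvPolynomial (Fin 4) ℂ}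
    (hk : e 0 + e 1 + e 2 + e 3 = k) (hr : r ∈ Iab a 3) (her : coeff e r ≠ 0)
    (hlt : ∀ f : Fin 4 →₀ ℕ, toLex f < toLex e → coeff f r = 0) :
    IsStandardExponent (k + 1 - a) e := by
  by_contra h
  obtain ⟨F, hF, hT, heF, hltF⟩ := exists_leading_taylorTwistedCubic_mem hk h
  have h0 := apolarPairing_eq_zero_of_mem_Iab hF hT hr
  rw [apolarPairing_apply, Finset.sum_eq_single e] at h0
  · refine mul_ne_zero (mul_ne_zero ?_ heF) her h0
    exact_mod_cast Finset.prod_ne_zero_iff.2 fun i _ => Nat.factorial_ne_zero _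
  · intro f _ hfe
    rcases lt_trichotomy (toLex f) (toLex e) with h | h | h
    · rw [hlt f h, mul_zero]
    · exact absurd (toLex.injective h) hfe
    · rw [hltF f h, mul_zero, zero_mul]
  · intro h
    exact absurd (mem_support_iff.2 heF) h

theorem finrank_Iab_three (a k : ℕ) (B : Finset (Fin 4 →₀ ℕ))
    (hB : ∀ e, e ∈ B ↔ e 0 + e 1 + e 2 + e 3 = k ∧ IsStandardExponent (k + 1 - a) e) :
    Module.finrank ℂ ↥(homogeneousSubmodule (Fin 4) ℂ k ⊓
      Submodule.restrictScalars ℂ (Iab a 3)) = B.card := by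
  rw [finrank_eq_card_of_trailing (ι := Lex (Fin 4 →₀ ℕ)) (fun e => lcoeff ℂ (ofLex e)) _
    (B.map toLex.toEmbedding), Finset.card_map]
  · intro e' he'
    obtain ⟨e, he, rfl⟩ := Finset.mem_map.1 he'
    obtain ⟨hk, hs⟩ := (hB e).1 he
    obtain ⟨r, hr, h1, h2⟩ := exists_mem_Iab_trailing hk hs
    exact ⟨r, hr, h1, fun f hf => h2 (ofLex f) hf⟩
  · rintro r ⟨hrk, hrI⟩ hr0
    obtain ⟨e, he, hmin⟩ := r.support.exists_min_image toLex (support_nonempty.2 hr0)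
    have hk : e 0 + e 1 + e 2 + e 3 = k := by
      have := (mem_homogeneousSubmodule _ _).1 hrk (mem_support_iff.1 he)
      simpa [Finsupp.weight_apply, Finsupp.sum_fintype, Fin.sum_univ_four] using this
    refine ⟨toLex e, Finset.mem_map_of_mem _ ((hB e).2 ⟨hk, ?_⟩), mem_support_iff.1 he⟩
    refine isStandardExponent_of_mem_Iab hk hrI (mem_support_iff.1 he) fun f hf => ?_
    by_contra h
    exact absurd (hmin f (mem_support_iff.2 h)) (not_le.2 hf)

theorem card_filter_add_lt {n p q : ℕ} (hp : n ≤ p) (hq : n ≤ q) :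
    ((Finset.range (p + 1) ×ˢ Finset.range (q + 1)).filter fun x => x.1 + x.2 < n).card =
      ∑ m ∈ Finset.range n, (m + 1) := by
  rw [Finset.card_eq_sum_card_fiberwise (f := fun x => x.1 + x.2) (t := Finset.range n)]
  · refine Finset.sum_congr rfl fun m hm => ?_
    rw [← Finset.Nat.card_antidiagonal m]
    congr 1
    ext x
    simp only [Finset.mem_filter, Finset.mem_product, Finset.mem_range,
      Finset.HasAntidiagonal.mem_antidiagonal] at hm ⊢
    omega
  · intro x hx
    simpa using (Finset.mem_filter.1 hx).2

theorem exists_finset_isStandardExponent (n k : ℕ) :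
    ∃ B : Finset (Fin 4 →₀ ℕ),
      (∀ e, e ∈ B ↔ e 0 + e 1 + e 2 + e 3 = k ∧ IsStandardExponent n e) ∧
      B.card = ∑ A ∈ Finset.range (k + 1), if A < n ∨ k - A < n then (A + 1) * (k - A + 1)
        else ∑ m ∈ Finset.range n, (m + 1) := by
  let T : Finset (Σ _ : ℕ, ℕ × ℕ) := (Finset.range (k + 1)).sigma fun A =>
    (Finset.range (A + 1) ×ˢ Finset.range (k - A + 1)).filter
      fun x => A < n ∨ k - A < n ∨ x.1 + x.2 < n
  let φ : (Σ _ : ℕ, ℕ × ℕ) → (Fin 4 →₀ ℕ) := fun y =>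
    Finsupp.equivFunOnFinite.symm ![y.2.1, y.1 - y.2.1, k - y.1 - y.2.2, y.2.2]
  refine ⟨T.image φ, fun e => ?_, ?_⟩
  · rw [Finset.mem_image]
    constructor
    · rintro ⟨⟨A, i, j⟩, hy, rfl⟩
      simp only [T, Finset.mem_sigma, Finset.mem_filter, Finset.mem_product, Finset.mem_range] at hy
      simp only [IsStandardExponent, φ, Finsupp.equivFunOnFinite_symm_apply_apply,
        Matrix.cons_val]
      omega
    · rintro ⟨hk, hs⟩
      refine ⟨⟨e 0 + e 1, e 0, e 3⟩, ?_, ?_⟩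
      · simp only [IsStandardExponent] at hs
        simp only [T, Finset.mem_sigma, Finset.mem_filter, Finset.mem_product, Finset.mem_range]
        omega
      · rw [Finsupp.ext_iff]
        simp [Fin.forall_fin_succ, φ]
        omega
  · rw [Finset.card_image_of_injOn, Finset.card_sigma]
    · refine Finset.sum_congr rfl fun A hA => ?_
      split_ifs with h
      · rw [Finset.filter_true_of_mem fun x _ => by tauto]
        simp
      · rw [← card_filter_add_lt (p := A) (q := k - A) (by omega) (by omega)]
        congr 1
        refine Finset.filter_congr fun x _ => by tauto
    · rintro ⟨A, i, j⟩ hy ⟨A', i', j'⟩ hy' h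
      simp only [T, Finset.coe_sigma, Set.mem_sigma_iff, Finset.mem_coe, Finset.mem_filter,
        Finset.mem_product, Finset.mem_range] at hy hy'
      have h0 := DFunLike.congr_fun h 0
      have h1 := DFunLike.congr_fun h 1
      have h3 := DFunLike.congr_fun h 3
      simp only [φ, Finsupp.equivFunOnFinite_symm_apply_apply, Matrix.cons_val] at h0 h1 h3
      obtain rfl : A = A' := by omega
      rw [h0, h3]

theorem six_mul_C3 {x : ℤ} (hx : 0 ≤ x) : 6 * C3 x = x * (x - 1) * (x - 2) := by
  lift x to ℕ using hx
  rw [C3, Int.toNat_natCast]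
  induction x with
  | zero => simp
  | succ m ih =>
    have h2 : 2 * ((m.choose 2 : ℕ) : ℤ) = m * (m - 1) := by
      clear ih
      induction m with
      | zero => simp
      | succ l ih =>
        rw [Nat.choose_succ_succ' l 1, Nat.choose_one_right]
        push_cast
        linear_combination ih
    rw [Nat.choose_succ_succ' m 2]
    push_cast
    linear_combination ih + 3 * h2

theorem C3_eq_zero {x : ℤ} (hx : x ≤ 2) : C3 x = 0 := by
  rw [C3, Nat.choose_eq_zero_of_lt (by omega), Nat.cast_zero]

theorem two_mul_sum_range_succ (n : ℕ) :
    2 * ∑ m ∈ Finset.range n, ((m : ℤ) + 1) = n * (n + 1) := by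
  induction n with
  | zero => simp
  | succ n ih =>
    rw [Finset.sum_range_succ]
    push_cast
    linear_combination ih

theorem six_mul_sum_range_mul (k : ℤ) (N : ℕ) :
    6 * ∑ A ∈ Finset.range N, ((A : ℤ) + 1) * (k - A + 1) = N * (N + 1) * (3 * k + 5 - 2 * N) := by
  induction N with
  | zero => simp
  | succ n ih =>
    rw [Finset.sum_range_succ]
    push_cast
    linear_combination ih

theorem six_mul_card_of_lt {n k : ℕ} (h : k < 2 * n) :
    6 * (∑ A ∈ Finset.range (k + 1), if A < n ∨ k - A < n then ((A : ℤ) + 1) * (k - A + 1)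
        else ∑ m ∈ Finset.range n, ((m : ℤ) + 1)) = (k + 1) * (k + 2) * (k + 3) := by
  rw [Finset.sum_congr rfl fun A hA => if_pos (by omega), six_mul_sum_range_mul]
  push_cast
  ring

theorem six_mul_card_of_eq {n k s : ℕ} (h : k = 2 * n + s) :
    6 * (∑ A ∈ Finset.range (k + 1), if A < n ∨ k - A < n then ((A : ℤ) + 1) * (k - A + 1)
        else ∑ m ∈ Finset.range n, ((m : ℤ) + 1)) =
      2 * (n * (n + 1) * (3 * k + 5 - 2 * n)) + 3 * (s + 1) * (n * (n + 1)) := by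
  have hsplit : ∀ f : ℕ → ℤ, ∑ A ∈ Finset.range (k + 1), f A =
      ∑ A ∈ Finset.range n, f A + ∑ A ∈ Finset.range (s + 1), f (n + A) +
        ∑ A ∈ Finset.range n, f (k - A) := by
    intro f
    rw [← Finset.sum_range_add, ← Finset.sum_range_reflect (fun A => f (k - A)),
      show k + 1 = n + (s + 1) + n by omega, Finset.sum_range_add _ (n + (s + 1))]
    congr 1
    refine Finset.sum_congr rfl fun A hA => ?_
    rw [Finset.mem_range] at hA
    congr 1
    omega
  rw [hsplit]
  have e1 : ∀ A ∈ Finset.range n, (if A < n ∨ k - A < n then ((A : ℤ) + 1) * (k - A + 1)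
      else ∑ m ∈ Finset.range n, ((m : ℤ) + 1)) = ((A : ℤ) + 1) * (k - A + 1) := fun A hA =>
    if_pos (Or.inl (Finset.mem_range.1 hA))
  have e2 : ∀ A ∈ Finset.range (s + 1), (if n + A < n ∨ k - (n + A) < n then
      (((n + A : ℕ) : ℤ) + 1) * (k - (n + A : ℕ) + 1)
      else ∑ m ∈ Finset.range n, ((m : ℤ) + 1)) = ∑ m ∈ Finset.range n, ((m : ℤ) + 1) :=
    fun A hA => if_neg (by rw [Finset.mem_range] at hA; omega)
  have e3 : ∀ A ∈ Finset.range n, (if k - A < n ∨ k - (k - A) < n then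
      (((k - A : ℕ) : ℤ) + 1) * (k - (k - A : ℕ) + 1)
      else ∑ m ∈ Finset.range n, ((m : ℤ) + 1)) = ((A : ℤ) + 1) * (k - A + 1) := by
    intro A hA
    rw [Finset.mem_range] at hA
    rw [if_pos (by omega), Nat.cast_sub (by omega)]
    ring
  rw [Finset.sum_congr rfl e1, Finset.sum_congr rfl e2, Finset.sum_congr rfl e3,
    Finset.sum_const, Finset.card_range, nsmul_eq_mul]
  have h1 := six_mul_sum_range_mul k n
  have h2 := two_mul_sum_range_succ n
  push_cast
  linear_combination 2 * h1 + 3 * ((s : ℤ) + 1) * h2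

/-- Hilbert function of `I_{a,3}`: the dimension of the degree-`k` component of the
ideal `I_{a,3} ⊆ ℂ[u_0,u_1,u_2,u_3]` equals
`(3a+1)·C(k−a+3,3) − (3a+2)·C(k−a+2,3) − (a(a+1)/2)·C(k−2a+3,3)
  + (a²+a+2)·C(k−2a+2,3) − (a(a+1)/2)·C(k−2a+1,3)`. -/
theorem hilbert_function_Ia3 (a : ℕ) (ha : 1 ≤ a) (k : ℕ) :
    (Module.finrank ℂ
      ↥(MvPolynomial.homogeneousSubmodule (Fin (3 + 1)) ℂ k ⊓
        Submodule.restrictScalars ℂ (Iab a 3)) : ℤ) =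
      (3 * (a : ℤ) + 1) * C3 ((k : ℤ) - a + 3) -
      (3 * (a : ℤ) + 2) * C3 ((k : ℤ) - a + 2) -
      ((a : ℤ) * (a + 1) / 2) * C3 ((k : ℤ) - 2 * a + 3) +
      ((a : ℤ) ^ 2 + a + 2) * C3 ((k : ℤ) - 2 * a + 2) -
      ((a : ℤ) * (a + 1) / 2) * C3 ((k : ℤ) - 2 * a + 1) := by
  obtain ⟨B, hB, hcard⟩ := exists_finset_isStandardExponent (k + 1 - a) k
  rw [finrank_Iab_three a k B hB, hcard]
  have hcast : ((∑ A ∈ Finset.range (k + 1), if A < k + 1 - a ∨ k - A < k + 1 - a then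
      (A + 1) * (k - A + 1) else ∑ m ∈ Finset.range (k + 1 - a), (m + 1) : ℕ) : ℤ) =
      ∑ A ∈ Finset.range (k + 1), if A < k + 1 - a ∨ k - A < k + 1 - a then
        ((A : ℤ) + 1) * (k - A + 1) else ∑ m ∈ Finset.range (k + 1 - a), ((m : ℤ) + 1) := by
    rw [Nat.cast_sum]
    refine Finset.sum_congr rfl fun A hA => ?_
    rw [Finset.mem_range] at hA
    rw [Nat.cast_ite]
    push_cast [Nat.cast_sub (show A ≤ k by omega)]
    rfl
  rw [hcast]
  obtain ⟨h, hh⟩ : ∃ h : ℤ, (a : ℤ) * (a + 1) = 2 * h := (Int.even_mul_succ_self a).two_dvd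
  have hdiv : (a : ℤ) * (a + 1) / 2 = h := by omega
  rw [hdiv]
  rcases lt_or_ge k a with hka | hka
  · rw [C3_eq_zero (by omega), C3_eq_zero (by omega), C3_eq_zero (by omega),
      C3_eq_zero (by omega), C3_eq_zero (by omega), show k + 1 - a = 0 by omega]
    simp
  have h1 := six_mul_C3 (show (0 : ℤ) ≤ k - a + 3 by omega)
  have h2 := six_mul_C3 (show (0 : ℤ) ≤ k - a + 2 by omega)
  rcases lt_or_ge k (2 * (k + 1 - a)) with hk | hk
  · have hsum := six_mul_card_of_lt hk
    have h3 := six_mul_C3 (show (0 : ℤ) ≤ k - 2 * a + 3 by omega)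
    have h4 := six_mul_C3 (show (0 : ℤ) ≤ k - 2 * a + 2 by omega)
    have h5 := six_mul_C3 (show (0 : ℤ) ≤ k - 2 * a + 1 by omega)
    refine mul_left_cancel₀ (show (12 : ℤ) ≠ 0 by norm_num) ?_
    linear_combination 2 * hsum - 2 * (3 * (a : ℤ) + 1) * h1 + 2 * (3 * (a : ℤ) + 2) * h2 +
      2 * h * h3 - 2 * ((a : ℤ) ^ 2 + a + 2) * h4 + 2 * h * h5 -
      (((k : ℤ) - 2 * a + 3) * (k - 2 * a + 2) * (k - 2 * a + 1) +
        ((k : ℤ) - 2 * a + 1) * (k - 2 * a) * (k - 2 * a - 1)) * hh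
  · obtain ⟨s, hs⟩ := Nat.exists_eq_add_of_le hk
    have hsum := six_mul_card_of_eq hs
    rw [C3_eq_zero (show (k : ℤ) - 2 * a + 3 ≤ 2 by omega),
      C3_eq_zero (show (k : ℤ) - 2 * a + 2 ≤ 2 by omega),
      C3_eq_zero (show (k : ℤ) - 2 * a + 1 ≤ 2 by omega)]
    have hn : ((k + 1 - a : ℕ) : ℤ) = k + 1 - a := by omega
    have hs' : (s : ℤ) = k - 2 * (k + 1 - a) := by omega
    rw [hn, hs'] at hsum
    refine mul_left_cancel₀ (show (6 : ℤ) ≠ 0 by norm_num) ?_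
    linear_combination hsum - (3 * (a : ℤ) + 1) * h1 + (3 * (a : ℤ) + 2) * h2
end

section
/- Let a ≥ 1, b ≥ 1 and d = ab. Let F, G ∈ MvPolynomial (Fin 2) ℂ be nonzero homogeneous binary forms in variables x, y of degrees d and b respectively. Then the Jacobian determinant ω(F,G) = (∂F/∂x)·(∂G/∂y) − (∂F/∂y)·(∂G/∂x) is the zero polynomial if and only if there exists a scalar c ∈ ℂ with F = c·G^a. (Criterion (1.3), after Hilbert and Abdesselam–Chipalkatti.) -/
open MvPolynomial

namespace MvPolynomial

theorem coeff_X_mul_pderiv {σ R : Type*} [CommSemiring R] (i : σ) (p : MvPolynomial σ R)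
    (m : σ →₀ ℕ) : coeff m (X i * pderiv i p) = m i * coeff m p := by
  classical
  induction p using MvPolynomial.induction_on' with
  | monomial u r =>
    rw [X_mul_pderiv_monomial, coeff_smul, coeff_monomial]
    split_ifs with h <;> simp [h]
  | add p q hp hq => rw [map_add, mul_add, coeff_add, hp, hq, coeff_add, mul_add]

variable {σ K : Type*} [Field K]

theorem coeff_mul_X_mul_pderiv_degree (ord : MonomialOrder σ) (i : σ) (p q : MvPolynomial σ K) :
    coeff (ord.degree p + ord.degree q) (p * (X i * pderiv i q)) =
      ord.degree q i * (ord.leadingCoeff p * ord.leadingCoeff q) := by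
  have hdeg : ord.toSyn (ord.degree (X i * pderiv i q)) ≤ ord.toSyn (ord.degree q) := by
    rw [ord.degree_le_iff]
    intro m hm
    apply ord.le_degree
    rw [mem_support_iff, coeff_X_mul_pderiv] at hm
    exact mem_support_iff.mpr (right_ne_zero_of_mul hm)
  rw [ord.coeff_mul_of_add_of_degree_le le_rfl hdeg, coeff_X_mul_pderiv]
  simp only [MonomialOrder.leadingCoeff]
  ring

/-- Nonzero polynomials with the same logarithmic derivatives have the same degree
with respect to every monomial order. -/
theorem degree_eq_of_mul_pderiv_eq [CharZero K] (ord : MonomialOrder σ)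
    {p q : MvPolynomial σ K} (hp : p ≠ 0) (hq : q ≠ 0)
    (h : ∀ i, q * pderiv i p = p * pderiv i q) : ord.degree p = ord.degree q := by
  ext i
  have key : q * (X i * pderiv i p) = p * (X i * pderiv i q) := by
    linear_combination X i * h i
  have hc := congrArg (coeff (ord.degree p + ord.degree q)) key
  rw [coeff_mul_X_mul_pderiv_degree, add_comm, coeff_mul_X_mul_pderiv_degree,
    mul_comm (ord.leadingCoeff q)] at hc
  have hne : ord.leadingCoeff p * ord.leadingCoeff q ≠ 0 :=
    mul_ne_zero (ord.leadingCoeff_ne_zero_iff.mpr hp) (ord.leadingCoeff_ne_zero_iff.mpr hq)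
  exact_mod_cast mul_right_cancel₀ hne hc

/-- Two polynomials with the same logarithmic derivatives are proportional. -/
theorem exists_eq_C_mul_of_mul_pderiv_eq [CharZero K] (ord : MonomialOrder σ)
    {p q : MvPolynomial σ K} (hq : q ≠ 0)
    (h : ∀ i, q * pderiv i p = p * pderiv i q) : ∃ c : K, p = C c * q := by
  have hlc : coeff (ord.degree q) q ≠ 0 := ord.leadingCoeff_ne_zero_iff.mpr hq
  refine ⟨coeff (ord.degree q) p / coeff (ord.degree q) q, ?_⟩
  by_contra hne
  set c := coeff (ord.degree q) p / coeff (ord.degree q) q with hc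
  have hr : p - C c * q ≠ 0 := sub_ne_zero.mpr hne
  have hdeg : ord.degree (p - C c * q) = ord.degree q := by
    refine degree_eq_of_mul_pderiv_eq ord hr hq fun i => ?_
    rw [map_sub, pderiv_C_mul]
    linear_combination h i
  apply ord.leadingCoeff_ne_zero_iff.mpr hr
  rw [MonomialOrder.leadingCoeff, hdeg, coeff_sub, coeff_C_mul, hc, div_mul_cancel₀ _ hlc,
    sub_self]

end MvPolynomial

/-- Criterion (1.3): for nonzero binary forms `F` of degree `d = ab` and `G` of degree `b`,
the Jacobian determinant `ω(F,G) = F_x·G_y − F_y·G_x` vanishes identically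
if and only if `F = c·G^a` for some scalar `c ∈ ℂ`. -/
theorem jacobian_vanishes_iff_power (a b : ℕ) (ha : 1 ≤ a) (hb : 1 ≤ b)
    (F G : MvPolynomial (Fin 2) ℂ) (hF0 : F ≠ 0) (hG0 : G ≠ 0)
    (hF : F.IsHomogeneous (a * b)) (hG : G.IsHomogeneous b) :
    MvPolynomial.pderiv (0 : Fin 2) F * MvPolynomial.pderiv (1 : Fin 2) G -
        MvPolynomial.pderiv (1 : Fin 2) F * MvPolynomial.pderiv (0 : Fin 2) G = 0 ↔
      ∃ c : ℂ, F = MvPolynomial.C c * G ^ a := by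
  constructor
  · intro h
    refine exists_eq_C_mul_of_mul_pderiv_eq MonomialOrder.lex (pow_ne_zero a hG0) ?_
    have eF := hF.sum_X_mul_pderiv
    have eG := hG.sum_X_mul_pderiv
    simp only [Fin.sum_univ_two, nsmul_eq_mul, Nat.cast_mul] at eF eG
    have hb0 : (b : MvPolynomial (Fin 2) ℂ) ≠ 0 := by
      exact_mod_cast (by omega : b ≠ 0)
    have hlog : ∀ i, G * pderiv i F = a * F * pderiv i G := by
      intro i
      apply mul_left_cancel₀ hb0
      fin_cases i <;> simp only [Fin.zero_eta, Fin.mk_one]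
      · linear_combination pderiv 0 G * eF - pderiv 0 F * eG + X 1 * h
      · linear_combination pderiv 1 G * eF - pderiv 1 F * eG - X 0 * h
    intro i
    obtain ⟨n, rfl⟩ := Nat.exists_eq_add_of_le' ha
    rw [pderiv_pow, Nat.add_sub_cancel, pow_succ]
    linear_combination G ^ n * hlog i
  · rintro ⟨c, rfl⟩
    simp only [pderiv_C_mul, pderiv_pow]
    ring
end

section
/- Let a ≥ 1, b ≥ 1, and in the polynomial ring ℂ[u_0,…,u_b] let J_{a,b} be the ideal generated by the monomials u_i^a for 0 ≤ i ≤ b together with the monomials u_i^j · u_{i+1}^{a−j} for 0 ≤ i ≤ b−1 and 1 ≤ j ≤ a−1. Then every monomial of total degree strictly greater than ⌊(b+2)/2⌋·(a−1) belongs to J_{a,b}, while the monomial Π_{0 ≤ i ≤ b, i even} u_i^{a−1}, which has total degree ⌊(b+2)/2⌋·(a−1), does not belong to J_{a,b}. (Key step in the proof of Theorem 1.3; J_{a,b} is the initial ideal of I_{a,b}.) -/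
open MvPolynomial

/-- The monomial ideal `J_{a,b} ⊆ ℂ[u_0,…,u_b]` generated by `u_i^a` for `0 ≤ i ≤ b`
and by `u_i^j u_{i+1}^{a−j}` for `0 ≤ i ≤ b−1`, `1 ≤ j ≤ a−1` (the initial ideal of
`I_{a,b}`). -/
noncomputable def Jab (a b : ℕ) : Ideal (MvPolynomial (Fin (b + 1)) ℂ) :=
  Ideal.span
    ((Set.range fun i : Fin (b + 1) => (MvPolynomial.X i : MvPolynomial (Fin (b + 1)) ℂ) ^ a) ∪
      {p : MvPolynomial (Fin (b + 1)) ℂ | ∃ (i : Fin b) (j : ℕ), 1 ≤ j ∧ j ≤ a - 1 ∧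
        p = MvPolynomial.X i.castSucc ^ j * MvPolynomial.X i.succ ^ (a - j)})

/-- A sequence whose consecutive sums are at most `c` has its first `n` terms summing to at most
`⌈n / 2⌉ * c`. -/
theorem sum_range_le_of_add_succ_le {f : ℕ → ℕ} {c : ℕ} (hf : ∀ i, f i + f (i + 1) ≤ c) (n : ℕ) :
    ∑ i ∈ Finset.range n, f i ≤ (n + 1) / 2 * c := by
  induction n using Nat.twoStepInduction with
  | zero => simp
  | one => simpa using (Nat.le_add_right _ _).trans (hf 0)
  | more n ih _ =>
    have h : (n + 2 + 1) / 2 = (n + 1) / 2 + 1 := by omega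
    rw [Finset.sum_range_succ, Finset.sum_range_succ, h, add_one_mul, add_assoc]
    exact add_le_add ih (hf n)

theorem sum_range_ite_even (c n : ℕ) :
    ∑ i ∈ Finset.range n, (if i % 2 = 0 then c else 0) = (n + 1) / 2 * c := by
  induction n with
  | zero => simp
  | succ n ih =>
    rw [Finset.sum_range_succ, ih]
    split_ifs with h
    · rw [show (n + 1 + 1) / 2 = (n + 1) / 2 + 1 by omega, add_one_mul]
    · rw [show (n + 1 + 1) / 2 = (n + 1) / 2 by omega, add_zero]

theorem exists_le_of_monomial_mem_Jab {a b : ℕ} {m : Fin (b + 1) →₀ ℕ}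
    (h : monomial m (1 : ℂ) ∈ Jab a b) :
    (∃ i, a ≤ m i) ∨ ∃ i : Fin b, a ≤ m i.castSucc + m i.succ := by
  have hJ : Jab a b = Ideal.span ((fun s => monomial s (1 : ℂ)) ''
      (Set.range (fun i : Fin (b + 1) => Finsupp.single i a) ∪
        {s | ∃ (i : Fin b) (j : ℕ), 1 ≤ j ∧ j ≤ a - 1 ∧
          s = Finsupp.single i.castSucc j + Finsupp.single i.succ (a - j)})) := by
    unfold Jab
    congr 1
    ext p
    simp only [Set.image_union, Set.mem_union, Set.mem_range, Set.mem_image, Set.mem_ofPred_eq,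
      exists_exists_eq_and, X_pow_eq_monomial, monomial_mul, one_mul]
    refine or_congr Iff.rfl ⟨?_, ?_⟩
    · rintro ⟨i, j, h₁, h₂, rfl⟩
      exact ⟨_, ⟨i, j, h₁, h₂, rfl⟩, rfl⟩
    · rintro ⟨_, ⟨i, j, h₁, h₂, rfl⟩, rfl⟩
      exact ⟨i, j, h₁, h₂, rfl⟩
  rw [hJ, mem_ideal_span_monomial_image] at h
  obtain ⟨s, hs, hle⟩ := h m (by simp [mem_support_iff])
  rcases hs with ⟨i, rfl⟩ | ⟨i, j, -, -, rfl⟩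
  · exact Or.inl ⟨i, by simpa using hle i⟩
  · refine Or.inr ⟨i, ?_⟩
    have h₁ := hle i.castSucc
    have h₂ := hle i.succ
    have hne : i.castSucc ≠ i.succ := i.castSucc_lt_succ.ne
    simp only [Finsupp.add_apply, Finsupp.single_eq_same, Finsupp.single_eq_of_ne hne,
      Finsupp.single_eq_of_ne hne.symm, add_zero, zero_add] at h₁ h₂
    omega

theorem monomial_mem_Jab_of_le {a b : ℕ} {m : Fin (b + 1) →₀ ℕ} {i : Fin (b + 1)}
    (h : a ≤ m i) : monomial m (1 : ℂ) ∈ Jab a b := by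
  refine Ideal.mem_of_dvd _ ?_ (Ideal.subset_span (Or.inl ⟨i, rfl⟩))
  simpa [X_pow_eq_monomial, monomial_dvd_monomial] using h

theorem monomial_mem_Jab_of_le_add {a b : ℕ} {m : Fin (b + 1) →₀ ℕ} {i : Fin b}
    (h : a ≤ m i.castSucc + m i.succ) : monomial m (1 : ℂ) ∈ Jab a b := by
  by_cases h₁ : a ≤ m i.castSucc
  · exact monomial_mem_Jab_of_le h₁
  by_cases h₂ : a ≤ m i.succ
  · exact monomial_mem_Jab_of_le h₂
  refine Ideal.mem_of_dvd _ ?_ (Ideal.subset_span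
    (Or.inr ⟨i, m i.castSucc, by omega, by omega, rfl⟩))
  rw [X_pow_eq_monomial, X_pow_eq_monomial, monomial_mul, one_mul, monomial_dvd_monomial]
  refine ⟨Or.inr fun k => ?_, one_dvd _⟩
  have hne : i.castSucc ≠ i.succ := i.castSucc_lt_succ.ne
  rw [Finsupp.add_apply, Finsupp.single_apply, Finsupp.single_apply]
  split_ifs with hk hk' hk'
  · exact absurd (hk.trans hk'.symm) hne
  · simp [← hk]
  · subst hk'
    omega
  · simp

/-- The product of the `c`-th powers of the even-indexed variables, as a monomial. -/
theorem prod_X_even_pow_eq_monomial (b c : ℕ) :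
    (∏ i : Fin (b + 1), if (i : ℕ) % 2 = 0 then
        (X i : MvPolynomial (Fin (b + 1)) ℂ) ^ c else 1) =
      monomial (Finsupp.equivFunOnFinite.symm
        fun i : Fin (b + 1) => if (i : ℕ) % 2 = 0 then c else 0) 1 := by
  rw [monomial_eq, C_1, one_mul, Finsupp.prod_fintype _ _ fun i => pow_zero _]
  refine Finset.prod_congr rfl fun i _ => ?_
  simp only [Finsupp.equivFunOnFinite_symm_apply_apply]
  split_ifs <;> simp

/-- Every monomial of total degree `> ⌊(b+2)/2⌋·(a−1)` belongs to `J_{a,b}`, while the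
monomial `∏_{i even} u_i^{a−1}`, of total degree `⌊(b+2)/2⌋·(a−1)`, does not. -/
theorem monomials_in_Jab (a b : ℕ) (ha : 1 ≤ a) (hb : 1 ≤ b) :
    (∀ m : Fin (b + 1) →₀ ℕ, (b + 2) / 2 * (a - 1) < m.sum (fun _ e => e) →
      MvPolynomial.monomial m (1 : ℂ) ∈ Jab a b) ∧
    (∏ i : Fin (b + 1), if (i : ℕ) % 2 = 0 then
        (MvPolynomial.X i : MvPolynomial (Fin (b + 1)) ℂ) ^ (a - 1) else 1).totalDegree =
      (b + 2) / 2 * (a - 1) ∧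
    (∏ i : Fin (b + 1), if (i : ℕ) % 2 = 0 then
        (MvPolynomial.X i : MvPolynomial (Fin (b + 1)) ℂ) ^ (a - 1) else 1) ∉ Jab a b := by
  refine ⟨fun m hm => ?_, ?_, fun hmem => ?_⟩
  · by_contra hmem
    let f : ℕ → ℕ := fun i => if h : i < b + 1 then m ⟨i, h⟩ else 0
    have hf : ∀ i, f i + f (i + 1) ≤ a - 1 := by
      intro i
      by_contra! hlt
      by_cases hi : i + 1 < b + 1
      · simp only [f, dif_pos hi, dif_pos (Nat.lt_of_succ_lt hi)] at hlt
        exact hmem (monomial_mem_Jab_of_le_add (i := ⟨i, by omega⟩)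
          (show a ≤ m ⟨i, _⟩ + m ⟨i + 1, _⟩ by omega))
      · by_cases hi' : i < b + 1
        · simp only [f, dif_neg hi, dif_pos hi'] at hlt
          exact hmem (monomial_mem_Jab_of_le (i := ⟨i, hi'⟩) (by omega))
        · simp only [f, dif_neg hi, dif_neg hi'] at hlt
          omega
    refine (sum_range_le_of_add_succ_le hf (b + 1)).not_gt ?_
    rw [← Fin.sum_univ_eq_sum_range]
    rw [Finsupp.sum_fintype _ _ fun _ => rfl] at hm
    simpa only [f, Fin.is_lt, dite_true, Fin.eta] using hm
  · rw [prod_X_even_pow_eq_monomial, totalDegree_monomial _ one_ne_zero,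
      Finsupp.sum_fintype _ _ fun _ => rfl]
    exact (Fin.sum_univ_eq_sum_range (fun i => if i % 2 = 0 then a - 1 else 0) (b + 1)).trans
      (sum_range_ite_even _ _)
  · rw [prod_X_even_pow_eq_monomial] at hmem
    rcases exists_le_of_monomial_mem_Jab hmem with ⟨i, hi⟩ | ⟨i, hi⟩
    · simp only [Finsupp.equivFunOnFinite_symm_apply_apply] at hi
      split_ifs at hi <;> omega
    · simp only [Finsupp.equivFunOnFinite_symm_apply_apply, Fin.val_castSucc, Fin.val_succ] at hi
      split_ifs at hi <;> omega
end

section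
/- Let a ≥ 2, b ≥ 2 be integers and d = ab. Then the following binomial identity holds in ℤ: Σ_{j=0}^{d−1} (−1)^{d+j−1} · C(d+1, j) · ( C(2d+b−j, d) − C(d+a(d−j)+b, b) ) = C(d−a+b, b) − C(d+b−1, b−1). (This is the identity implicit in Proposition 4.4, obtained by computing the last Betti number β_d of the variety of a-th powers of binary b-forms in two different ways.) -/
/-- The `n`-th alternating binomial sum of a polynomial of degree less than `n` vanishes. -/
theorem alternating_sum_choose_mul_eval_eq_zero {R : Type*} [CommRing R] {P : Polynomial R}
    {n : ℕ} (hP : P.natDegree < n) :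
    ∑ j ∈ Finset.range (n + 1), (-1 : R) ^ j * (n.choose j : R) * P.eval (j : R) = 0 := by
  have h := congrFun (Polynomial.fwdDiff_iter_eq_zero_of_degree_lt hP) 0
  rw [fwdDiff_iter_eq_sum_shift] at h
  have h' := congrArg (fun x => (-1 : R) ^ n * x) h
  simp only [Pi.zero_apply, mul_zero, Finset.mul_sum] at h'
  rw [← h']
  refine Finset.sum_congr rfl fun j hj => ?_
  have hj : j ≤ n := Nat.lt_succ_iff.mp (Finset.mem_range.mp hj)
  have hs : (-1 : R) ^ n * (-1) ^ (n - j) = (-1) ^ j := by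
    rw [← pow_add, show n + (n - j) = j + 2 * (n - j) by omega, pow_add, pow_mul]
    simp
  simp only [zero_add, nsmul_eq_mul, mul_one, zsmul_eq_mul, Int.cast_mul, Int.cast_pow,
    Int.cast_neg, Int.cast_one, Int.cast_natCast]
  rw [← hs]
  ring

/-- Composing `x ↦ C(x, k)` with a linear polynomial gives a polynomial of degree at most `k`. -/
theorem exists_polynomial_eval_eq_choose (k : ℕ) {L : Polynomial ℚ} (hL : L.natDegree ≤ 1) :
    ∃ P : Polynomial ℚ, P.natDegree ≤ k ∧
      ∀ (x : ℚ) (m : ℕ), L.eval x = m → P.eval x = (m.choose k : ℚ) := by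
  refine ⟨Polynomial.C ((k.factorial : ℚ)⁻¹) * (descPochhammer ℚ k).comp L, ?_, fun x m hx => ?_⟩
  · refine (Polynomial.natDegree_C_mul_le _ _).trans (Polynomial.natDegree_comp_le.trans ?_)
    rw [descPochhammer_natDegree]
    exact (Nat.mul_le_mul_left k hL).trans (mul_one k).le
  · rw [Polynomial.eval_mul, Polynomial.eval_C, Polynomial.eval_comp, hx,
      descPochhammer_eval_eq_descFactorial, Nat.descFactorial_eq_factorial_mul_choose,
      Nat.cast_mul, inv_mul_cancel_left₀ (Nat.cast_ne_zero.mpr k.factorial_ne_zero)]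

/-- Alternating binomial sums of order `d + 1` annihilate a difference of two binomial
coefficients of order at most `d` whose upper entries depend linearly on the index. -/
theorem alternating_sum_choose_mul_choose_sub_choose (d k l : ℕ) (hk : k ≤ d) (hl : l ≤ d)
    (u v : ℕ → ℕ) (p q r s : ℚ)
    (hu : ∀ j ≤ d + 1, (u j : ℚ) = p * j + q) (hv : ∀ j ≤ d + 1, (v j : ℚ) = r * j + s) :
    ∑ j ∈ Finset.range (d + 2), (-1 : ℤ) ^ j * ((d + 1).choose j : ℤ) *
      (((u j).choose k : ℤ) - ((v j).choose l : ℤ)) = 0 := by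
  obtain ⟨P, hP, hPe⟩ := exists_polynomial_eval_eq_choose k
    (Polynomial.natDegree_linear_le (a := p) (b := q))
  obtain ⟨Q, hQ, hQe⟩ := exists_polynomial_eval_eq_choose l
    (Polynomial.natDegree_linear_le (a := r) (b := s))
  have hPQ : (P - Q).natDegree < d + 1 := by
    have := Polynomial.natDegree_sub_le P Q
    omega
  have h := alternating_sum_choose_mul_eval_eq_zero hPQ
  rw [← Int.cast_inj (α := ℚ), Int.cast_zero, ← h]
  push_cast
  refine Finset.sum_congr rfl fun j hj => ?_
  have hj : j ≤ d + 1 := Nat.lt_succ_iff.mp (Finset.mem_range.mp hj)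
  rw [Polynomial.eval_sub, hPe _ (u j) (by simp [hu j hj]), hQe _ (v j) (by simp [hv j hj])]


/-- Binomial identity implicit in Proposition 4.4: for `a, b ≥ 2` and `d = ab`,
`Σ_{j=0}^{d−1} (−1)^{d+j−1} C(d+1, j) (C(2d+b−j, d) − C(d+a(d−j)+b, b))
   = C(d−a+b, b) − C(d+b−1, b−1)`. -/
theorem last_betti_number_identity (a b : ℕ) (ha : 2 ≤ a) (hb : 2 ≤ b) :
    ∑ j ∈ Finset.range (a * b),
        (-1 : ℤ) ^ (a * b + j - 1) * ((a * b + 1).choose j : ℤ) *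
          (((2 * (a * b) + b - j).choose (a * b) : ℤ) -
            ((a * b + a * (a * b - j) + b).choose b : ℤ)) =
      ((a * b - a + b).choose b : ℤ) - ((a * b + b - 1).choose (b - 1) : ℤ) := by
  have had : a ≤ a * b := Nat.le_mul_of_pos_right a (by omega)
  have hbd : b ≤ a * b := Nat.le_mul_of_pos_left b (by omega)
  generalize a * b = d at had hbd ⊢
  have h := alternating_sum_choose_mul_choose_sub_choose d d b le_rfl hbd
    (fun j => 2 * d + b - j) (fun j => d + a * (d + 1 - j) + b - a)
    (-1) (2 * d + b) (-a) (d + a * d + b)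
    (fun j hj => by
      rw [Nat.cast_sub (by omega)]
      push_cast
      ring)
    (fun j hj => by
      rw [Nat.cast_sub (by omega)]
      push_cast [Nat.cast_sub hj]
      ring)
  have hsymm : (d + b).choose d = (d + b).choose b := Nat.choose_symm_add
  have hlast : (2 * d + b - (d + 1)).choose d = (d + b - 1).choose (b - 1) := by
    rw [show 2 * d + b - (d + 1) = d + (b - 1) by omega, Nat.choose_symm_add,
      Nat.add_sub_assoc (by omega)]
  rw [Finset.sum_range_succ, Finset.sum_range_succ] at h
  simp only [Nat.choose_self, Nat.sub_self, hlast, Nat.add_sub_cancel_left,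
    show 2 * d + b - d = d + b by omega, show d + a * 1 + b - a = d + b by omega,
    show d + b - a = d - a + b by omega, hsymm, sub_self, mul_zero, add_zero] at h
  have hterm : ∀ j ∈ Finset.range d,
      (-1 : ℤ) ^ (d + j - 1) * ((d + 1).choose j : ℤ) *
          (((2 * d + b - j).choose d : ℤ) - ((d + a * (d - j) + b).choose b : ℤ)) =
        (-1) ^ (d + 1) * ((-1 : ℤ) ^ j * ((d + 1).choose j : ℤ) *
          (((2 * d + b - j).choose d : ℤ) -
            ((d + a * (d + 1 - j) + b - a).choose b : ℤ))) := by
    intro j hj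
    have hj : j < d := Finset.mem_range.mp hj
    have hs : (-1 : ℤ) ^ (d + 1) * (-1) ^ j = (-1) ^ (d + j - 1) := by
      rw [← pow_add, show d + 1 + j = d + j - 1 + 2 by omega, pow_add]
      simp
    have hv : d + a * (d + 1 - j) + b - a = d + a * (d - j) + b := by
      rw [show d + 1 - j = d - j + 1 by omega, mul_add, mul_one]
      omega
    rw [hv, ← hs]
    ring
  rw [Finset.sum_congr rfl hterm, ← Finset.mul_sum, eq_neg_of_add_eq_zero_left h]
  have hsq : (-1 : ℤ) ^ (d + 1) * (-1) ^ (d + 1) = 1 := by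
    rw [← mul_pow]
    simp
  push_cast
  linear_combination (((d - a + b).choose b : ℤ) - ((d + b - 1).choose (b - 1) : ℤ)) * hsq
end
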